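/- Let q be a connected element of the graph group G_F containing the symbol α, and let p be an α-peak with p ≤ pq. Then there exist an α-peak r and an integer t ≥ 0 with p = r·q^t (i.e., p = rq^t and |p| = |r| + t|q|) and |r| ≤ 2|pqp⁻¹|². -/

import Mathlib

open Pointwise

namespace GraphGroupPaper

/-- The set of commutator relators: `gᵢ` and `gⱼ` commute for every pair of distinct
`i, j` with `{i,j} ∉ F`. -/
def Rels (k : ℕ) (F : Set (Sym2 (Fin k))) : Set (FreeGroup (Fin k)) :=
  {w | ∃ i j : Fin k, i ≠ j ∧ s(i, j) ∉ F ∧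
      w = FreeGroup.of i * FreeGroup.of j * (FreeGroup.of i)⁻¹ * (FreeGroup.of j)⁻¹}

/-- The graph group `G_F` with generators `g₁, …, g_k` and relations `gᵢgⱼ = gⱼgᵢ`
for all distinct `i, j` with `{i,j} ∉ F`. -/
abbrev Grp (k : ℕ) (F : Set (Sym2 (Fin k))) := PresentedGroup (Rels k F)

/-- The generator `gᵢ` of the graph group. -/
def gen (k : ℕ) (F : Set (Sym2 (Fin k))) (i : Fin k) : Grp k F :=
  PresentedGroup.of i

/-- The group element corresponding to a symbol: `(i, true)` stands for `gᵢ`,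
`(i, false)` stands for `gᵢ⁻¹`. -/
def sym (k : ℕ) (F : Set (Sym2 (Fin k))) (α : Fin k × Bool) : Grp k F :=
  if α.2 then gen k F α.1 else (gen k F α.1)⁻¹

/-- The product of the word `l` of symbols, as an element of the graph group. -/
def wordProd (k : ℕ) (F : Set (Sym2 (Fin k))) (l : List (Fin k × Bool)) : Grp k F :=
  (l.map (sym k F)).prod

/-- `|x|` : the length of a shortest word in the symbols representing `x`. -/
noncomputable def len {k : ℕ} {F : Set (Sym2 (Fin k))} (x : Grp k F) : ℕ :=
  sInf {n | ∃ l : List (Fin k × Bool), wordProd k F l = x ∧ l.length = n}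

/-- The partial order on `G_F`:  `x ≤ y` iff `|y| = |x| + |x⁻¹y|`. -/
def le {k : ℕ} {F : Set (Sym2 (Fin k))} (x y : Grp k F) : Prop :=
  len y = len x + len (x⁻¹ * y)

/-- `m` is the meet `x ∧ y` (greatest lower bound w.r.t. `le`). -/
def IsMeet {k : ℕ} {F : Set (Sym2 (Fin k))} (x y m : Grp k F) : Prop :=
  le m x ∧ le m y ∧ ∀ w, le w x → le w y → le w m

/-- `j` is the (finite) join `x ∨ y` (least upper bound w.r.t. `le`);
`x ∨ y` is finite iff such a `j` exists. -/
def IsJoin {k : ℕ} {F : Set (Sym2 (Fin k))} (x y j : Grp k F) : Prop :=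
  le x j ∧ le y j ∧ ∀ w, le x w → le y w → le j w

/-- `j` is the (finite) join of the set `S`. -/
def IsJoinSet {k : ℕ} {F : Set (Sym2 (Fin k))} (S : Set (Grp k F)) (j : Grp k F) : Prop :=
  (∀ s ∈ S, le s j) ∧ ∀ w, (∀ s ∈ S, le s w) → le j w

/-- `y` is a segment of `a` if `a = x·y·z` for some `x, z`. -/
def Segment {k : ℕ} {F : Set (Sym2 (Fin k))} (y a : Grp k F) : Prop :=
  ∃ x z, a = x * y * z ∧ len a = len x + len y + len z

/-- The left-invariant metric `dist(x,y) = |x⁻¹y|`. -/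
noncomputable def dist {k : ℕ} {F : Set (Sym2 (Fin k))} (x y : Grp k F) : ℕ :=
  len (x⁻¹ * y)

/-- A nonempty set `L` is convex if `x, z ∈ L` and `dist(x,y) + dist(y,z) = dist(x,z)`
imply `y ∈ L`. -/
def ConvexSet {k : ℕ} {F : Set (Sym2 (Fin k))} (L : Set (Grp k F)) : Prop :=
  L.Nonempty ∧ ∀ x z y : Grp k F, x ∈ L → z ∈ L →
    dist x y + dist y z = dist x z → y ∈ L

/-- An ideal: nonempty, downward closed, and closed under finite joins. -/
def IdealSet {k : ℕ} {F : Set (Sym2 (Fin k))} (I : Set (Grp k F)) : Prop :=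
  I.Nonempty ∧ (∀ x ∈ I, ∀ y, le y x → y ∈ I) ∧
    (∀ x ∈ I, ∀ y ∈ I, ∀ j, IsJoin x y j → j ∈ I)

/-- `H` is closed if both `H` and `H⁻¹` are ideals. -/
def ClosedSet {k : ℕ} {F : Set (Sym2 (Fin k))} (H : Set (Grp k F)) : Prop :=
  IdealSet H ∧ IdealSet H⁻¹

/-- `m` is a minimal element of `S` w.r.t. `le`. -/
def MinimalIn {k : ℕ} {F : Set (Sym2 (Fin k))} (S : Set (Grp k F)) (m : Grp k F) : Prop :=
  m ∈ S ∧ ∀ x ∈ S, le x m → x = m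

/-- `l` is a reduced (i.e. shortest) word representing `x`. -/
def MinWord {k : ℕ} {F : Set (Sym2 (Fin k))} (x : Grp k F) (l : List (Fin k × Bool)) : Prop :=
  wordProd k F l = x ∧ l.length = len x

open Classical in
/-- `#_α(x)`: the number of occurrences of the symbol `α` (not counting `α⁻¹`)
in a reduced word representing `x`. -/
noncomputable def symCount {k : ℕ} {F : Set (Sym2 (Fin k))} (α : Fin k × Bool)
    (x : Grp k F) : ℕ :=
  if h : ∃ l, MinWord x l then h.choose.count α else 0

/-- The symbol `α` occurs in `x`. -/
def Occurs {k : ℕ} {F : Set (Sym2 (Fin k))} (α : Fin k × Bool) (x : Grp k F) : Prop :=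
  0 < symCount α x

/-- `α` is a maximal symbol of `x`, i.e. `xα⁻¹ ≤ x`. -/
def MaxSym {k : ℕ} {F : Set (Sym2 (Fin k))} (α : Fin k × Bool) (x : Grp k F) : Prop :=
  le (x * (sym k F α)⁻¹) x

/-- A peak: an element with precisely one maximal symbol. -/
def IsPeak {k : ℕ} {F : Set (Sym2 (Fin k))} (p : Grp k F) : Prop :=
  ∃! α : Fin k × Bool, MaxSym α p

/-- An `α`-peak: a peak whose unique maximal symbol is `α`. -/
def AlphaPeak {k : ℕ} {F : Set (Sym2 (Fin k))} (α : Fin k × Bool) (p : Grp k F) : Prop :=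
  MaxSym α p ∧ ∀ β, MaxSym β p → β = α

/-- The set of generator indices occurring in `b`. -/
def Support {k : ℕ} {F : Set (Sym2 (Fin k))} (b : Grp k F) : Set (Fin k) :=
  {i | Occurs (i, true) b ∨ Occurs (i, false) b}

/-- `b` is connected: the generators occurring in `b` induce a connected subgraph of
the graph `([k], F)`. -/
def Conn {k : ℕ} {F : Set (Sym2 (Fin k))} (b : Grp k F) : Prop :=
  (SimpleGraph.induce (Support b) (SimpleGraph.fromEdgeSet F)).Connected

/-- `b` is cyclically reduced: `b ∧ b⁻¹ = 1`. -/
def CycRed {k : ℕ} {F : Set (Sym2 (Fin k))} (b : Grp k F) : Prop :=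
  IsMeet b b⁻¹ 1

/-- The generators `gᵢ` and `gⱼ` are equal or not forced to commute. -/
def Dep {k : ℕ} (F : Set (Sym2 (Fin k))) (i j : Fin k) : Prop := i = j ∨ s(i, j) ∈ F

/-- The monoid of families of words indexed by the pairs of dependent generators. -/
abbrev PairWords (k : ℕ) (F : Set (Sym2 (Fin k))) :=
  {e : Fin k × Fin k // Dep F e.1 e.2} → FreeMonoid (Fin k × Bool)

/-- The trace of a word: the family of its projections to pairs of dependent generators.
Two words have the same trace iff they differ by commutations of independent letters. -/
def trace {k : ℕ} (F : Set (Sym2 (Fin k))) (w : List (Fin k × Bool)) : PairWords k F :=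
  fun e => FreeMonoid.ofList (w.filter fun a => a.1 = e.1.1 ∨ a.1 = e.1.2)

/-- The trace of a one-letter word. -/
def letter {k : ℕ} (F : Set (Sym2 (Fin k))) (a : Fin k × Bool) : PairWords k F := trace F [a]

/-- The inverse symbol. -/
def invSym {k : ℕ} (a : Fin k × Bool) : Fin k × Bool := (a.1, !a.2)

/-- The formal inverse of a word. -/
def invWord {k : ℕ} (w : List (Fin k × Bool)) : List (Fin k × Bool) := (w.map invSym).reverse

section

variable {k : ℕ} {F : Set (Sym2 (Fin k))}

@[simp] lemma invSym_invSym (a : Fin k × Bool) : invSym (invSym a) = a := by simp [invSym]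

@[simp] lemma invSym_fst (a : Fin k × Bool) : (invSym a).1 = a.1 := rfl

lemma Dep.refl (i : Fin k) : Dep F i i := Or.inl rfl

lemma Dep.symm {i j : Fin k} (h : Dep F i j) : Dep F j i := by
  rcases h with h | h
  · exact Or.inl h.symm
  · exact Or.inr (Sym2.eq_swap ▸ h)

@[simp] lemma trace_nil : trace F [] = 1 := rfl

@[simp] lemma trace_append (u v : List (Fin k × Bool)) :
    trace F (u ++ v) = trace F u * trace F v := by
  funext e
  simp [trace, FreeMonoid.ofList_append]

@[simp] lemma trace_cons (a : Fin k × Bool) (u : List (Fin k × Bool)) :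
    trace F (a :: u) = letter F a * trace F u := by
  rw [letter, ← trace_append, List.singleton_append]

lemma trace_congr_filter {u v : List (Fin k × Bool)} (h : trace F u = trace F v)
    {i j : Fin k} (hij : Dep F i j) :
    u.filter (fun a => a.1 = i ∨ a.1 = j) = v.filter (fun a => a.1 = i ∨ a.1 = j) :=
  congrFun h ⟨(i, j), hij⟩

lemma trace_eq_of_filter {u v : List (Fin k × Bool)} (h : ∀ i j, Dep F i j →
    u.filter (fun a => a.1 = i ∨ a.1 = j) = v.filter (fun a => a.1 = i ∨ a.1 = j)) :
    trace F u = trace F v := by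
  funext ⟨⟨i, j⟩, hij⟩
  exact congrArg FreeMonoid.ofList (h i j hij)

lemma trace_reverse {u v : List (Fin k × Bool)} (h : trace F u = trace F v) :
    trace F u.reverse = trace F v.reverse := by
  refine trace_eq_of_filter fun i j hij => ?_
  rw [List.filter_reverse, List.filter_reverse, trace_congr_filter h hij]

lemma perm_of_trace_eq {u v : List (Fin k × Bool)} (h : trace F u = trace F v) :
    u.Perm v := by
  refine List.perm_iff_count.2 fun a => ?_
  have := congrArg (List.count a) (trace_congr_filter h (Dep.refl a.1))
  simpa [List.count_filter] using this

lemma letter_commute {a b : Fin k × Bool} (h : ¬ Dep F a.1 b.1) :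
    Commute (letter F a) (letter F b) := by
  rw [Commute, SemiconjBy, letter, letter, ← trace_append, ← trace_append]
  refine trace_eq_of_filter fun i j hij => ?_
  have h1 : ¬ ((a.1 = i ∨ a.1 = j) ∧ (b.1 = i ∨ b.1 = j)) := by
    rintro ⟨rfl | rfl, h2 | h2⟩
    · exact h (Or.inl h2.symm)
    · exact h (h2 ▸ hij)
    · exact h (h2 ▸ hij.symm)
    · exact h (Or.inl h2.symm)
  by_cases ha : a.1 = i ∨ a.1 = j <;> by_cases hb : b.1 = i ∨ b.1 = j <;>
    simp_all

lemma letter_commute_trace {a : Fin k × Bool} {v : List (Fin k × Bool)}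
    (h : ∀ c ∈ v, ¬ Dep F a.1 c.1) : Commute (letter F a) (trace F v) := by
  induction v with
  | nil => exact Commute.one_right _
  | cons b v ih =>
    rw [trace_cons]
    exact (letter_commute (h b (by simp))).mul_right (ih fun c hc => h c (by simp [hc]))

lemma exists_split_of_head {b : Fin k × Bool} {w : List (Fin k × Bool)}
    (h : ∀ j, Dep F b.1 j → (w.filter fun a => a.1 = b.1 ∨ a.1 = j).head? = some b) :
    ∃ v u, w = v ++ b :: u ∧ ∀ c ∈ v, ¬ Dep F b.1 c.1 := by
  induction w with
  | nil => simpa using h b.1 (Dep.refl _)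
  | cons c w ih =>
    by_cases hcb : c = b
    · exact ⟨[], w, by simp [hcb], by simp⟩
    have hc : ¬ Dep F b.1 c.1 := fun hd => hcb (by simpa using h c.1 hd)
    obtain ⟨v, u, rfl, hv⟩ := ih fun j hj => by
      have h1 : ¬ (c.1 = b.1 ∨ c.1 = j) := by
        rintro (h2 | rfl)
        · exact hc (Or.inl h2.symm)
        · exact hc hj
      simpa [List.filter_cons, h1] using h j hj
    exact ⟨c :: v, u, by simp, List.forall_mem_cons.2 ⟨hc, hv⟩⟩

/-- If a trace begins with a letter, so does every word for it, up to moving that letter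
past independent letters. -/
lemma exists_split_of_letter_mul {b : Fin k × Bool} {w : List (Fin k × Bool)}
    {x : PairWords k F} (h : trace F w = letter F b * x) :
    ∃ v u, w = v ++ b :: u ∧ (∀ c ∈ v, ¬ Dep F b.1 c.1) ∧ x = trace F (v ++ u) := by
  obtain ⟨v, u, rfl, hv⟩ := exists_split_of_head (F := F) (b := b) (w := w) fun j hj => by
    have h1 := congrArg FreeMonoid.toList (congrFun h ⟨(b.1, j), hj⟩)
    have h2 : FreeMonoid.toList (letter F b ⟨(b.1, j), hj⟩) = [b] := by
      simp [letter, trace]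
    rw [Pi.mul_apply, FreeMonoid.toList_mul, h2] at h1
    change List.filter _ w = _ at h1
    rw [h1]
    rfl
  refine ⟨v, u, rfl, hv, ?_⟩
  rw [trace_append, trace_cons, ← mul_assoc, ← (letter_commute_trace hv).eq, mul_assoc] at h
  rw [trace_append, ← mul_left_cancel h]

lemma exists_split_of_mul_letter {b : Fin k × Bool} {w x : List (Fin k × Bool)}
    (h : trace F w = trace F x * letter F b) :
    ∃ v u, w = v ++ b :: u ∧ ∀ c ∈ u, ¬ Dep F b.1 c.1 := by
  have h1 : trace F w = trace F (x ++ [b]) := by simpa using h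
  have h2 := trace_reverse h1
  rw [List.reverse_append, List.reverse_singleton, List.singleton_append, trace_cons] at h2
  obtain ⟨v, u, hw, hv, -⟩ := exists_split_of_letter_mul h2
  refine ⟨u.reverse, v.reverse, ?_, by simpa using hv⟩
  simpa using congrArg List.reverse hw

lemma trace_split_right {b : Fin k × Bool} {v u : List (Fin k × Bool)}
    (h : ∀ c ∈ u, ¬ Dep F b.1 c.1) :
    trace F (v ++ b :: u) = trace F (v ++ u) * letter F b := by
  simp [mul_assoc, (letter_commute_trace h).eq]

lemma trace_split_left {b : Fin k × Bool} {v u : List (Fin k × Bool)}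
    (h : ∀ c ∈ v, ¬ Dep F b.1 c.1) :
    trace F (v ++ b :: u) = letter F b * trace F (v ++ u) := by
  simp [← mul_assoc, (letter_commute_trace h).eq]

/-- Prefixes of traces can be detected on projections. -/
lemma exists_trace_mul {u v : List (Fin k × Bool)}
    (h : ∀ i j, Dep F i j → u.filter (fun a => a.1 = i ∨ a.1 = j) <+:
      v.filter (fun a => a.1 = i ∨ a.1 = j)) :
    ∃ w, trace F v = trace F u * trace F w := by
  induction u generalizing v with
  | nil => exact ⟨v, by simp⟩
  | cons b u ih =>
    obtain ⟨v, w, rfl, hv⟩ := exists_split_of_head (F := F) (b := b) (w := v) fun j hj => by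
      obtain ⟨t, ht⟩ := h b.1 j hj
      rw [← ht]
      simp
    have hs := trace_split_left (u := w) hv
    obtain ⟨t, ht⟩ := ih (v := v ++ w) fun i j hij => by
      have h1 := h i j hij
      rw [← trace_cons] at hs
      rw [trace_congr_filter hs hij, List.filter_cons, List.filter_cons] at h1
      split_ifs at h1
      · exact (List.cons_prefix_cons.1 h1).2
      · exact h1
    exact ⟨t, by rw [hs, ht, trace_cons, mul_assoc]⟩

lemma sym_invSym (a : Fin k × Bool) : sym k F (invSym a) = (sym k F a)⁻¹ := by
  rcases a with ⟨i, _ | _⟩ <;> simp [sym, invSym]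

lemma gen_commute {i j : Fin k} (h : ¬ Dep F i j) : Commute (gen k F i) (gen k F j) := by
  have h1 : (QuotientGroup.mk (FreeGroup.of i * FreeGroup.of j * (FreeGroup.of i)⁻¹ *
      (FreeGroup.of j)⁻¹) : Grp k F) = 1 :=
    PresentedGroup.one_of_mem ⟨i, j, fun e => h (Or.inl e), fun e => h (Or.inr e), rfl⟩
  have h2 : gen k F i * gen k F j * (gen k F i)⁻¹ * (gen k F j)⁻¹ = 1 := h1
  rw [mul_inv_eq_one, mul_inv_eq_iff_eq_mul] at h2
  exact h2

lemma sym_commute {a b : Fin k × Bool} (h : ¬ Dep F a.1 b.1) :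
    Commute (sym k F a) (sym k F b) := by
  have := gen_commute h
  unfold sym
  split_ifs
  · exact this
  · exact this.inv_right
  · exact this.inv_left
  · exact this.inv_inv

@[simp] lemma wordProd_nil : wordProd k F [] = 1 := rfl

@[simp] lemma wordProd_append (u v : List (Fin k × Bool)) :
    wordProd k F (u ++ v) = wordProd k F u * wordProd k F v := by
  simp [wordProd]

@[simp] lemma wordProd_cons (a : Fin k × Bool) (u : List (Fin k × Bool)) :
    wordProd k F (a :: u) = sym k F a * wordProd k F u := by
  simp [wordProd]

lemma invWord_cons (a : Fin k × Bool) (u : List (Fin k × Bool)) :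
    invWord (a :: u) = invWord u ++ [invSym a] := by
  simp [invWord]

lemma wordProd_invWord (u : List (Fin k × Bool)) :
    wordProd k F (invWord u) = (wordProd k F u)⁻¹ := by
  induction u with
  | nil => simp [invWord]
  | cons a u ih => simp [invWord_cons, ih, sym_invSym]

lemma sym_commute_wordProd {a : Fin k × Bool} {v : List (Fin k × Bool)}
    (h : ∀ c ∈ v, ¬ Dep F a.1 c.1) : Commute (sym k F a) (wordProd k F v) := by
  induction v with
  | nil => exact Commute.one_right _
  | cons b v ih =>
    rw [wordProd_cons]
    exact (sym_commute (h b (by simp))).mul_right (ih fun c hc => h c (by simp [hc]))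

lemma wordProd_eq_of_trace_eq {u v : List (Fin k × Bool)} (h : trace F u = trace F v) :
    wordProd k F u = wordProd k F v := by
  induction u generalizing v with
  | nil => rw [List.nil_perm.1 (perm_of_trace_eq h)]
  | cons a u ih =>
    rw [trace_cons] at h
    obtain ⟨s, t, rfl, hs, hx⟩ := exists_split_of_letter_mul h.symm
    rw [wordProd_append, wordProd_cons, wordProd_cons, ih hx, wordProd_append, ← mul_assoc,
      ← mul_assoc, (sym_commute_wordProd hs).eq]

/-- A word is freely reduced if no commutations bring two inverse letters next to
each other. -/
def Reduced (F : Set (Sym2 (Fin k))) (w : List (Fin k × Bool)) : Prop :=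
  ∀ u v b, trace F w ≠ trace F (u ++ b :: invSym b :: v)

lemma Reduced.congr {u v : List (Fin k × Bool)} (hu : Reduced F u)
    (h : trace F u = trace F v) : Reduced F v := fun s t b hb => hu s t b (h.trans hb)

lemma Reduced.left {u v : List (Fin k × Bool)} (h : Reduced F (u ++ v)) : Reduced F u :=
  fun s t b hb => h s (t ++ v) b (by rw [trace_append, hb]; simp [mul_assoc])

lemma Reduced.right {u v : List (Fin k × Bool)} (h : Reduced F (u ++ v)) : Reduced F v :=
  fun s t b hb => h (u ++ s) t b (by rw [trace_append, hb]; simp)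

lemma reduced_nil : Reduced F [] := fun u v b h => by
  simpa using (perm_of_trace_eq h).length_eq

lemma Reduced.cons {a : Fin k × Bool} {w : List (Fin k × Bool)} (hw : Reduced F w)
    (h : ∀ u, trace F w ≠ letter F (invSym a) * trace F u) : Reduced F (a :: w) := by
  intro u v b hb
  rw [trace_cons] at hb
  obtain ⟨s, t, hst, hs, hx⟩ := exists_split_of_letter_mul hb.symm
  rcases List.append_eq_append_iff.1 hst with ⟨l, rfl, h2⟩ | ⟨l, rfl, h2⟩
  · rcases l with _ | ⟨c, _ | ⟨d, l⟩⟩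
    · simp only [List.nil_append, List.cons.injEq] at h2
      obtain ⟨rfl, rfl⟩ := h2
      rw [List.append_nil] at hs hx
      exact h (u ++ v) (by rw [hx, trace_split_left (by simpa using hs)])
    · simp only [List.cons_append, List.nil_append, List.cons.injEq] at h2
      obtain ⟨rfl, rfl, rfl⟩ := h2
      exact hs b (by simp) (Dep.refl _)
    · simp only [List.cons_append, List.cons.injEq] at h2
      obtain ⟨rfl, rfl, rfl⟩ := h2
      exact hw u (l ++ t) b (by rw [hx]; simp)
  · rcases l with _ | ⟨c, l⟩
    · simp only [List.nil_append, List.cons.injEq] at h2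
      obtain ⟨rfl, rfl⟩ := h2
      exact h (s ++ v) (by rw [hx, trace_split_left (by simpa using hs)])
    · simp only [List.cons_append, List.cons.injEq] at h2
      obtain ⟨rfl, rfl⟩ := h2
      exact hw (s ++ l) v b (by rw [hx]; simp)

/-- `y` is the trace obtained from `x` by multiplying with the symbol `a` and reducing. -/
def Step (a : Fin k × Bool) (x y : PairWords k F) : Prop :=
  y = letter F a * x ∨ x = letter F (invSym a) * y

lemma Step.symm {a : Fin k × Bool} {x y : PairWords k F} (h : Step a x y) :
    Step (invSym a) y x := by
  rcases h with h | h
  · exact Or.inr (by simpa using h)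
  · exact Or.inl h

/-- The traces of reduced words. -/
abbrev RedTrace (F : Set (Sym2 (Fin k))) := {x : PairWords k F // ∃ w, Reduced F w ∧ trace F w = x}

lemma RedTrace.ne_letter_mul (x : RedTrace F) (a : Fin k × Bool) (u : List (Fin k × Bool)) :
    x.1 ≠ letter F a * (letter F (invSym a) * trace F u) := by
  obtain ⟨x, w, hw, rfl⟩ := x
  intro h
  exact hw [] u a (by simpa using h)

lemma RedTrace.exists_step (a : Fin k × Bool) (x : RedTrace F) :
    ∃ y : RedTrace F, Step a x.1 y.1 := by
  obtain ⟨x, w, hw, rfl⟩ := x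
  by_cases h : ∃ u, trace F w = letter F (invSym a) * trace F u
  · obtain ⟨u, hu⟩ := h
    rw [← trace_cons] at hu
    exact ⟨⟨trace F u, u, (hw.congr hu).right (u := [invSym a]), rfl⟩,
      Or.inr (by simpa using hu)⟩
  · push Not at h
    exact ⟨⟨trace F (a :: w), _, hw.cons h, rfl⟩, Or.inl (by simp)⟩

lemma RedTrace.step_unique {a : Fin k × Bool} {x y z : RedTrace F} (hy : Step a x.1 y.1)
    (hz : Step a x.1 z.1) : y = z := by
  rcases hy with hy | hy <;> rcases hz with hz | hz
  · exact Subtype.ext (hy.trans hz.symm)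
  · obtain ⟨u, -, hu⟩ := z.2
    exact absurd (by rw [hy, hz, hu]) (y.ne_letter_mul a u)
  · obtain ⟨u, -, hu⟩ := y.2
    exact absurd (by rw [hz, hy, hu]) (z.ne_letter_mul a u)
  · exact Subtype.ext (mul_left_cancel (hy.symm.trans hz))

lemma exists_of_letter_mul_eq {a b : Fin k × Bool} (hab : ¬ Dep F a.1 b.1) {x y : RedTrace F}
    (h : letter F a * x.1 = letter F b * y.1) :
    ∃ u, x.1 = letter F b * trace F u ∧ y.1 = letter F a * trace F u := by
  obtain ⟨x, w, hw, rfl⟩ := x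
  simp only at h ⊢
  rw [← trace_cons] at h
  obtain ⟨v, u, hvu, hv, hx⟩ := exists_split_of_letter_mul h
  rcases v with _ | ⟨c, v⟩
  · simp only [List.nil_append, List.cons.injEq] at hvu
    exact absurd (Or.inl (congrArg Prod.fst hvu.1)) hab
  · simp only [List.cons_append, List.cons.injEq] at hvu
    obtain ⟨rfl, rfl⟩ := hvu
    exact ⟨v ++ u, trace_split_left fun c hc => hv c (by simp [hc]), by simpa using hx⟩

lemma step_comm {a b : Fin k × Bool} (hab : ¬ Dep F a.1 b.1) {x y z t : RedTrace F}
    (hxy : Step a x.1 y.1) (hyz : Step b y.1 z.1) (hxt : Step b x.1 t.1) :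
    Step a t.1 z.1 := by
  have hc : ∀ {a' b' : Fin k × Bool}, a'.1 = a.1 → b'.1 = b.1 → ∀ s : PairWords k F,
      letter F a' * (letter F b' * s) = letter F b' * (letter F a' * s) := by
    intro a' b' ha hb s
    rw [← mul_assoc, (letter_commute (by rwa [ha, hb])).eq, mul_assoc]
  rcases hxy with hxy | hxy <;> rcases hyz with hyz | hyz <;> rcases hxt with hxt | hxt
  · exact Or.inl (by rw [hyz, hxy, hxt, hc rfl rfl])
  · obtain ⟨u, -, hu⟩ := t.2
    refine absurd ?_ (z.ne_letter_mul b (a :: u))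
    rw [hyz, hxy, hxt, hc (b' := invSym b) rfl rfl, trace_cons, hu]
  · obtain ⟨u, hu, -⟩ := exists_of_letter_mul_eq (b := invSym b) hab (hxy.symm.trans hyz)
    exact absurd (by rw [hxt, hu]) (t.ne_letter_mul b u)
  · obtain ⟨u, hu, hz⟩ := exists_of_letter_mul_eq (b := invSym b) hab (hxy.symm.trans hyz)
    exact Or.inl (by rw [hz, ← mul_left_cancel (hu.symm.trans hxt)])
  · exact Or.inr (by rw [hxt, hxy, hyz, hc (a' := invSym a) rfl rfl])
  · obtain ⟨u, hu, -⟩ :=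
      exists_of_letter_mul_eq (a := invSym a) (b := invSym b) hab (hxy.symm.trans hxt)
    exact absurd (by rw [hyz, hu]) (z.ne_letter_mul b u)
  · obtain ⟨u, -, hu⟩ := z.2
    refine absurd ?_ (t.ne_letter_mul b (invSym a :: u))
    rw [hxt, hxy, hyz, hc (a' := invSym a) (b' := invSym b) rfl rfl, trace_cons, hu]
  · refine Or.inr (mul_left_cancel (a := letter F (invSym b)) ?_)
    rw [← hxt, hxy, hyz, hc (a' := invSym a) (b' := invSym b) rfl rfl]

/-- The action of a symbol on reduced traces. -/
noncomputable def act (a : Fin k × Bool) (x : RedTrace F) : RedTrace F :=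
  (RedTrace.exists_step a x).choose

lemma step_act (a : Fin k × Bool) (x : RedTrace F) : Step a x.1 (act a x).1 :=
  (RedTrace.exists_step a x).choose_spec

/-- The action of a generator on reduced traces, as a permutation. -/
noncomputable def actPerm (i : Fin k) : Equiv.Perm (RedTrace F) where
  toFun := act (i, true)
  invFun := act (i, false)
  left_inv x := RedTrace.step_unique (step_act _ _) (step_act (i, true) x).symm
  right_inv x := RedTrace.step_unique (step_act _ _) (step_act (i, false) x).symm

lemma actPerm_rels (r : FreeGroup (Fin k)) (hr : r ∈ Rels k F) :
    FreeGroup.lift (actPerm (F := F)) r = 1 := by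
  obtain ⟨i, j, hij, hF, rfl⟩ := hr
  have h : ¬ Dep F i j := fun h => h.elim hij hF
  simp only [map_mul, map_inv, FreeGroup.lift_apply_of]
  rw [mul_inv_eq_one, mul_inv_eq_iff_eq_mul]
  ext1 x
  exact RedTrace.step_unique (a := (i, true)) (step_act _ _)
    (step_comm (b := (j, true)) h (step_act _ x) (step_act _ _) (step_act _ _))

/-- The action of the graph group on reduced traces. -/
noncomputable def actHom : Grp k F →* Equiv.Perm (RedTrace F) :=
  PresentedGroup.toGroup actPerm_rels

lemma step_actHom (a : Fin k × Bool) (x : RedTrace F) :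
    Step a x.1 (actHom (sym k F a) x).1 := by
  have h (i : Fin k) : actHom (gen k F i) = actPerm i := PresentedGroup.toGroup.of actPerm_rels
  rcases a with ⟨i, _ | _⟩
  · simp only [sym, Bool.false_eq_true, if_false, map_inv, h]
    exact step_act (i, false) x
  · simp only [sym, if_true, h]
    exact step_act (i, true) x

lemma actHom_wordProd {w : List (Fin k × Bool)} (hw : Reduced F w) :
    actHom (wordProd k F w) ⟨1, [], reduced_nil, rfl⟩ = ⟨trace F w, w, hw, rfl⟩ := by
  induction w with
  | nil => simp
  | cons a w ih =>
    rw [wordProd_cons, map_mul, Equiv.Perm.mul_apply, ih (hw.right (u := [a]))]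
    exact RedTrace.step_unique (step_actHom _ _) (Or.inl (by simp))

lemma trace_eq_of_wordProd_eq {u v : List (Fin k × Bool)} (hu : Reduced F u)
    (hv : Reduced F v) (h : wordProd k F u = wordProd k F v) : trace F u = trace F v := by
  have := actHom_wordProd hu
  rw [h, actHom_wordProd hv] at this
  exact congrArg Subtype.val this.symm

lemma len_le_length (w : List (Fin k × Bool)) : len (wordProd k F w) ≤ w.length :=
  Nat.sInf_le ⟨w, rfl, rfl⟩

lemma exists_wordProd_eq (x : Grp k F) : ∃ w, wordProd k F w = x := by
  induction x using PresentedGroup.induction_on with | _ z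
  induction z using FreeGroup.induction_on with
  | C1 => exact ⟨[], by simp⟩
  | of i => exact ⟨[(i, true)], by simp [sym, gen, PresentedGroup.of]⟩
  | inv_of i h => exact ⟨[(i, false)], by simp [sym, gen, PresentedGroup.of]⟩
  | mul x y hx hy =>
    obtain ⟨u, hu⟩ := hx
    obtain ⟨v, hv⟩ := hy
    exact ⟨u ++ v, by simp [hu, hv]⟩

lemma exists_minWord (x : Grp k F) : ∃ w, MinWord x w := by
  obtain ⟨w, hw⟩ := exists_wordProd_eq x
  exact Nat.sInf_mem (s := {n | ∃ l : List (Fin k × Bool), wordProd k F l = x ∧ l.length = n})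
    ⟨_, w, hw, rfl⟩

lemma reduced_of_length_le {w : List (Fin k × Bool)} (h : w.length ≤ len (wordProd k F w)) :
    Reduced F w := by
  intro u v b hb
  have h1 := (perm_of_trace_eq hb).length_eq
  have h2 := len_le_length (F := F) (u ++ v)
  have h3 : wordProd k F w = wordProd k F (u ++ v) := by
    rw [wordProd_eq_of_trace_eq hb]
    simp [sym_invSym]
  rw [h3] at h
  simp only [List.length_append, List.length_cons] at *
  omega

lemma Reduced.len_eq {w : List (Fin k × Bool)} (hw : Reduced F w) :
    len (wordProd k F w) = w.length := by
  obtain ⟨u, hu, hl⟩ := exists_minWord (wordProd k F w)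
  have := trace_eq_of_wordProd_eq (reduced_of_length_le (by rw [hu, hl])) hw hu
  rw [← hl, (perm_of_trace_eq this).length_eq]

lemma exists_reduced (x : Grp k F) : ∃ w, Reduced F w ∧ wordProd k F w = x := by
  obtain ⟨w, hw, hl⟩ := exists_minWord x
  exact ⟨w, reduced_of_length_le (by rw [hw, hl]), hw⟩

lemma occurs_iff {a : Fin k × Bool} {w : List (Fin k × Bool)} (hw : Reduced F w) :
    Occurs a (wordProd k F w) ↔ a ∈ w := by
  have h := exists_minWord (wordProd k F w)
  obtain ⟨h1, h2⟩ := h.choose_spec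
  have h3 := trace_eq_of_wordProd_eq (reduced_of_length_le (by rw [h1, h2])) hw h1
  rw [Occurs, symCount, dif_pos h, List.count_pos_iff, (perm_of_trace_eq h3).mem_iff]

lemma maxSym_iff {a : Fin k × Bool} {w : List (Fin k × Bool)} (hw : Reduced F w) :
    MaxSym a (wordProd k F w) ↔ ∃ u, trace F w = trace F u * letter F a := by
  have ha : Reduced F [a] := reduced_nil.cons fun u hu => by
    rw [← trace_cons] at hu
    simpa using (perm_of_trace_eq hu).length_eq
  have hl : len (sym k F a) = 1 := by simpa using ha.len_eq
  have he : (wordProd k F w * (sym k F a)⁻¹)⁻¹ * wordProd k F w = sym k F a := by group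
  rw [MaxSym, le, he, hl, hw.len_eq]
  constructor
  · intro h
    obtain ⟨u, hu, hl⟩ := exists_reduced (wordProd k F w * (sym k F a)⁻¹)
    rw [← hl, hu.len_eq] at h
    have h1 : wordProd k F (u ++ [a]) = wordProd k F w := by simp [hl]
    have h2 : Reduced F (u ++ [a]) := reduced_of_length_le (by simp [h1, hw.len_eq, h])
    exact ⟨u, by simpa using (trace_eq_of_wordProd_eq h2 hw h1).symm⟩
  · rintro ⟨u, hu⟩
    have h1 : trace F w = trace F (u ++ [a]) := by simpa using hu
    have h2 : wordProd k F w * (sym k F a)⁻¹ = wordProd k F u := by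
      rw [wordProd_eq_of_trace_eq h1]
      simp
    rw [h2, (hw.congr h1).left.len_eq, (perm_of_trace_eq h1).length_eq]
    simp
end

section

variable {k : ℕ} {F : Set (Sym2 (Fin k))}

lemma exists_cancel_of_not_reduced_append {u v : List (Fin k × Bool)} (hu : Reduced F u)
    (hv : Reduced F v) (h : ¬ Reduced F (u ++ v)) :
    ∃ s t b, trace F u = trace F s * letter F b ∧
      trace F v = letter F (invSym b) * trace F t := by
  induction u with
  | nil => exact absurd hv h
  | cons c u ih =>
    by_cases hr : Reduced F (u ++ v)
    · by_contra hn
      refine h (hr.cons fun x hx => ?_)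
      obtain ⟨s, t, hst, hs, -⟩ := exists_split_of_letter_mul hx
      have key : ∀ l, s = u ++ l → v ≠ l ++ invSym c :: t := by
        rintro l rfl rfl
        refine hn ⟨u, l ++ t, c, ?_, ?_⟩
        · rw [trace_cons,
            (letter_commute_trace (a := c) (v := u) fun d hd => hs d (by simp [hd])).eq]
        · exact trace_split_left fun d hd => hs d (by simp [hd])
      rcases List.append_eq_append_iff.1 hst with ⟨l, h1, h2⟩ | ⟨l, h1, h2⟩
      · exact key l h1 h2
      · rcases l with _ | ⟨d, l⟩
        · exact key [] (by simpa using h1.symm) (by simpa using h2.symm)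
        · simp only [List.cons_append, List.cons.injEq] at h2
          obtain ⟨rfl, -⟩ := h2
          refine hu [] (s ++ l) c ?_
          rw [trace_cons, h1, trace_split_left hs]
          simp
    · obtain ⟨s, t, b, hs, ht⟩ := ih (hu.right (u := [c])) hr
      exact ⟨c :: s, t, b, by rw [trace_cons, hs, trace_cons, mul_assoc], ht⟩

/-- A product of two reduced words is reduced after cancelling a common part. -/
lemma exists_cancellation {u v : List (Fin k × Bool)} (hu : Reduced F u) (hv : Reduced F v) :
    ∃ s m t, trace F u = trace F (s ++ invWord m) ∧ trace F v = trace F (m ++ t) ∧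
      Reduced F (s ++ t) := by
  induction hn : u.length generalizing u v with
  | zero =>
    rw [List.length_eq_zero_iff.1 hn]
    exact ⟨[], [], v, by simp [invWord], by simp, hv⟩
  | succ n ih =>
    by_cases hr : Reduced F (u ++ v)
    · exact ⟨u, [], v, by simp [invWord], by simp, hr⟩
    obtain ⟨s, t, b, hs, ht⟩ := exists_cancel_of_not_reduced_append hu hv hr
    have hs' : trace F u = trace F (s ++ [b]) := by simpa using hs
    rw [← trace_cons] at ht
    have hl : s.length = n := by
      have := (perm_of_trace_eq hs').length_eq
      simp only [List.length_append, List.length_singleton] at this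
      omega
    obtain ⟨s1, m, t1, h1, h2, h3⟩ :=
      ih (hu.congr hs').left ((hv.congr ht).right (u := [_])) hl
    refine ⟨s1, invSym b :: m, t1, ?_, ?_, h3⟩
    · rw [hs, h1, invWord_cons]
      simp [mul_assoc]
    · rw [ht, trace_cons, h2]
      simp

end

lemma append_self_prefix_of_append_eq_append {A : Type*} {d z q : List A}
    (h : d ++ z = z ++ q) (hl : 2 * d.length ≤ z.length) : d ++ d <+: z := by
  obtain ⟨z, rfl⟩ := List.prefix_of_prefix_length_le (List.prefix_append d z)
    (h ▸ List.prefix_append z q) (by omega)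
  rw [List.append_assoc, List.append_cancel_left_eq] at h
  obtain ⟨z, rfl⟩ := List.prefix_of_prefix_length_le (List.prefix_append d z)
    (h ▸ List.prefix_append z q) (by simp at hl; omega)
  exact ⟨z, by simp⟩

lemma countP_le_of_append_eq_append {A : Type*} {d z q : List A} (f g : A → Bool)
    (h : d ++ z = z ++ q) {c : ℕ} (hc : z.countP f < c * d.countP f) :
    z.countP g ≤ c * d.countP g := by
  induction c generalizing z with
  | zero => simp at hc
  | succ c ih =>
    rcases le_total d.length z.length with hl | hl
    · obtain ⟨z, rfl⟩ := List.prefix_of_prefix_length_le (List.prefix_append d z)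
        (h ▸ List.prefix_append z q) hl
      rw [List.append_assoc, List.append_cancel_left_eq] at h
      rw [List.countP_append] at hc ⊢
      have := ih h (by linarith)
      linarith
    · have := (List.prefix_of_prefix_length_le (h ▸ List.prefix_append z q)
        (List.prefix_append d z) hl).sublist.countP_le (p := g)
      nlinarith [Nat.zero_le (c * d.countP g)]

lemma exists_last_of_mem {A : Type*} {p : A → Prop} {w : List A} (h : ∃ a ∈ w, ¬ p a) :
    ∃ v a u, w = v ++ a :: u ∧ ¬ p a ∧ ∀ b ∈ u, p b := by
  induction w with
  | nil => simp at h
  | cons a w ih =>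
    by_cases hw : ∃ a ∈ w, ¬ p a
    · obtain ⟨v, b, u, rfl, hb, hu⟩ := ih hw
      exact ⟨a :: v, b, u, by simp, hb, hu⟩
    · push Not at hw
      obtain ⟨b, hb, hpb⟩ := h
      rcases List.mem_cons.1 hb with rfl | hb
      · exact ⟨[], b, w, by simp, hpb, hw⟩
      · exact absurd (hw b hb) hpb

/-- The number of letters of a word with a given index. -/
def indexCount {k : ℕ} (i : Fin k) (w : List (Fin k × Bool)) : ℕ := w.countP fun a => a.1 = i

section

variable {k : ℕ} {F : Set (Sym2 (Fin k))}

lemma indexCount_pos {i : Fin k} {w : List (Fin k × Bool)} :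
    0 < indexCount i w ↔ ∃ a ∈ w, a.1 = i := by
  simp [indexCount, List.countP_pos_iff]

lemma length_eq_sum_indexCount (w : List (Fin k × Bool)) :
    w.length = ∑ i, indexCount i w := by
  induction w with
  | nil => simp [indexCount]
  | cons a w ih =>
    simp only [indexCount] at ih
    simp [indexCount, List.countP_cons, Finset.sum_add_distrib, ih]

lemma length_filter_eq {i j : Fin k} (w : List (Fin k × Bool)) :
    (w.filter fun a => a.1 = i ∨ a.1 = j).length =
      indexCount i w + if i = j then 0 else indexCount j w := by
  induction w with
  | nil => simp [indexCount]
  | cons a w ih =>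
    simp only [indexCount, List.filter_cons, List.countP_cons] at ih ⊢
    grind

lemma filter_append_eq {d z q : List (Fin k × Bool)} (h : trace F (d ++ z) = trace F (z ++ q))
    {i j : Fin k} (hij : Dep F i j) :
    d.filter (fun a => a.1 = i ∨ a.1 = j) ++ z.filter (fun a => a.1 = i ∨ a.1 = j) =
      z.filter (fun a => a.1 = i ∨ a.1 = j) ++ q.filter (fun a => a.1 = i ∨ a.1 = j) := by
  simpa only [List.filter_append] using trace_congr_filter h hij

lemma perm_of_trace_append_eq {d z q : List (Fin k × Bool)}
    (h : trace F (d ++ z) = trace F (z ++ q)) : d.Perm q :=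
  (List.perm_append_left_iff z).1 (List.perm_append_comm.trans (perm_of_trace_eq h))

lemma indexCount_le_of_dep {d z q : List (Fin k × Bool)}
    (h : trace F (d ++ z) = trace F (z ++ q)) {i j : Fin k} (hij : Dep F i j) {c : ℕ}
    (hc : indexCount i z < c * indexCount i q) : indexCount j z ≤ c * indexCount j q := by
  have hf (w : List (Fin k × Bool)) (l : Fin k) (hl : l = i ∨ l = j) :
      (w.filter fun a => a.1 = i ∨ a.1 = j).countP (fun a => a.1 = l) = indexCount l w := by
    rw [List.countP_filter, indexCount]
    refine List.countP_congr fun a _ => ?_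
    simp only [Bool.and_eq_true, decide_eq_true_eq]
    grind
  have hd (l : Fin k) : indexCount l d = indexCount l q := (perm_of_trace_append_eq h).countP_eq _
  have := countP_le_of_append_eq_append (fun a => a.1 = i) (fun a => a.1 = j)
    (filter_append_eq h hij) (c := c)
  simp only [hf _ i (Or.inl rfl), hf _ j (Or.inr rfl), hd] at this
  exact this hc

lemma indexCount_lt_of_walk {d z q : List (Fin k × Bool)}
    (h : trace F (d ++ z) = trace F (z ++ q)) {S : Set (Fin k)}
    (hS : ∀ i ∈ S, 0 < indexCount i q) {x y : S}
    (w : (SimpleGraph.induce S (SimpleGraph.fromEdgeSet F)).Walk x y) {c : ℕ}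
    (hc : indexCount x.1 z < c * indexCount x.1 q) :
    indexCount y.1 z < (c + w.length) * indexCount y.1 q := by
  induction w generalizing c with
  | nil => simpa using hc
  | @cons x x' y hadj w ih =>
    have hdep : Dep F x.1 x'.1 := Or.inr (by simpa using hadj.1)
    have h1 := indexCount_le_of_dep h hdep hc
    have h2 := ih (c := c + 1) (by have := hS x'.1 x'.2; linarith)
    rw [SimpleGraph.Walk.length_cons]
    convert h2 using 2
    ring

lemma mem_support_iff {w : List (Fin k × Bool)} (hw : Reduced F w) {i : Fin k} :
    i ∈ Support (wordProd k F w) ↔ 0 < indexCount i w := by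
  rw [indexCount_pos]
  change Occurs _ _ ∨ Occurs _ _ ↔ _
  rw [occurs_iff hw, occurs_iff hw]
  constructor
  · rintro (h | h)
    exacts [⟨_, h, rfl⟩, ⟨_, h, rfl⟩]
  · rintro ⟨⟨j, _ | _⟩, h, rfl⟩
    exacts [Or.inr h, Or.inl h]

lemma indexCount_le_of_conn {d z q : List (Fin k × Bool)} (hq : Reduced F q)
    (hconn : Conn (wordProd k F q)) (h : trace F (d ++ z) = trace F (z ++ q)) {i j : Fin k}
    (hi : indexCount i z < 2 * indexCount i q) (hj : 0 < indexCount j q) :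
    indexCount j z ≤ (q.length + 1) * indexCount j q := by
  classical
  have hi0 : 0 < indexCount i q := by omega
  obtain ⟨w, hw⟩ := (hconn.preconnected ⟨i, (mem_support_iff hq).2 hi0⟩
    ⟨j, (mem_support_iff hq).2 hj⟩).exists_isPath
  have h1 := indexCount_lt_of_walk h (fun i hi => (mem_support_iff hq).1 hi) w hi
  have h2 : w.length < q.length := by
    refine hw.length_lt.trans_le ?_
    rw [Fintype.card_of_subtype (q.map Prod.fst).toFinset]
    · exact (List.toFinset_card_le _).trans (by simp)
    · intro l
      rw [mem_support_iff hq, indexCount_pos]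
      simp
  exact h1.le.trans (Nat.mul_le_mul_right _ (by omega))

lemma exists_of_two_mul_le {d z q : List (Fin k × Bool)}
    (h : trace F (d ++ z) = trace F (z ++ q))
    (h2 : ∀ i, 2 * indexCount i q ≤ indexCount i z) :
    ∃ s, trace F z = trace F s * trace F q * trace F q := by
  have hd (l : Fin k) : indexCount l d = indexCount l q := (perm_of_trace_append_eq h).countP_eq _
  obtain ⟨s, hs⟩ := exists_trace_mul (F := F) (u := d ++ d) (v := z) fun i j hij => by
    rw [List.filter_append]
    refine append_self_prefix_of_append_eq_append (filter_append_eq h hij) ?_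
    rw [length_filter_eq, length_filter_eq, hd, hd]
    have := h2 i
    have := h2 j
    split_ifs <;> omega
  refine ⟨s, ?_⟩
  rw [trace_append] at hs
  have h3 : trace F d * trace F s = trace F s * trace F q := by
    rw [trace_append, trace_append, hs] at h
    simp only [mul_assoc, mul_right_inj] at h
    exact h
  rw [hs, mul_assoc, h3, ← mul_assoc, h3]

lemma exists_trace_eq_of_append {b m p q : List (Fin k × Bool)}
    (h : trace F (b ++ p) = trace F (m ++ p ++ q)) :
    ∃ d, trace F b = trace F (m ++ d) ∧ trace F (d ++ p) = trace F (p ++ q) := by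
  obtain ⟨d, hd⟩ := exists_trace_mul (F := F) (u := m) (v := b) fun i j hij => by
    have h1 := trace_congr_filter h hij
    simp only [List.filter_append, List.append_assoc] at h1
    have h2 := congrArg List.length h1
    simp only [List.length_append] at h2
    exact List.prefix_of_prefix_length_le (List.prefix_append _ _)
      (h1 ▸ List.prefix_append _ _) (by omega)
  refine ⟨d, by simpa using hd, ?_⟩
  rw [trace_append, hd] at h
  simp only [trace_append, mul_assoc, mul_right_inj] at h
  simpa using h

/-- If `p` is a peak whose top symbol occurs in the connected element `q`, and `z` is an
upper part of `p` with `dz = zq`, then all indices of `z` occur in `q`. -/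
lemma indexCount_pos_of_peak {d m z q : List (Fin k × Bool)} {a : Fin k × Bool}
    (ha : a ∈ q) (h : trace F (d ++ z) = trace F (z ++ q))
    (hp : ∀ b u, trace F (m ++ z) = trace F u * letter F b → b = a) :
    ∀ c ∈ z, 0 < indexCount c.1 q := by
  by_contra hn
  obtain ⟨v, c, u, rfl, hc, hu⟩ := exists_last_of_mem
    (p := fun c : Fin k × Bool => 0 < indexCount c.1 q) (w := z)
    (by push Not at hn; simpa only [not_lt] using hn)
  have hind : ∀ b ∈ u, ¬ Dep F c.1 b.1 := by
    intro b hb hdep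
    have h1 := indexCount_le_of_dep h hdep.symm (c := indexCount b.1 (v ++ c :: u) + 1)
      (by have := hu b hb; nlinarith)
    have h2 : 0 < indexCount c.1 (v ++ c :: u) := indexCount_pos.2 ⟨c, by simp, rfl⟩
    rw [Nat.eq_zero_of_not_pos hc] at h1
    omega
  have := hp c (m ++ (v ++ u)) (by
    rw [trace_append m, trace_split_right hind, trace_append m (v ++ u), mul_assoc])
  exact hc (this ▸ indexCount_pos.2 ⟨a, ha, rfl⟩)

lemma length_le_or_exists {p q b : List (Fin k × Bool)} {a : Fin k × Bool}
    (hpq : Reduced F (p ++ q)) (hb : Reduced F b)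
    (hbp : wordProd k F b * wordProd k F p = wordProd k F (p ++ q))
    (hconn : Conn (wordProd k F q)) (ha : a ∈ q)
    (hp : ∀ b u, trace F p = trace F u * letter F b → b = a) :
    p.length ≤ 2 * b.length ^ 2 ∨ ∃ s, trace F p = trace F s * trace F q * trace F q := by
  obtain ⟨s, m, z, h1, h2, h3⟩ := exists_cancellation hb hpq.left
  have h4 : trace F (s ++ z) = trace F (m ++ z ++ q) := by
    have h5 : trace F (p ++ q) = trace F (m ++ z ++ q) := by
      rw [trace_append, h2, ← trace_append]
    rw [← h5]
    refine trace_eq_of_wordProd_eq h3 hpq ?_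
    rw [← hbp, wordProd_eq_of_trace_eq h1, wordProd_eq_of_trace_eq h2]
    simp [wordProd_invWord]
  obtain ⟨d, h5, h6⟩ := exists_trace_eq_of_append h4
  have hpos := indexCount_pos_of_peak ha h6 (m := m) (by simpa only [h2] using hp)
  by_cases h7 : ∀ i, 2 * indexCount i q ≤ indexCount i z
  · obtain ⟨t, ht⟩ := exists_of_two_mul_le h6 h7
    exact Or.inr ⟨m ++ t, by rw [h2, trace_append, ht, trace_append]; simp only [mul_assoc]⟩
  · left
    push Not at h7
    obtain ⟨i, hi⟩ := h7
    have h8 : z.length ≤ (q.length + 1) * q.length := by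
      rw [length_eq_sum_indexCount z]
      nth_rw 2 [length_eq_sum_indexCount q]
      rw [Finset.mul_sum]
      refine Finset.sum_le_sum fun j _ => ?_
      rcases Nat.eq_zero_or_pos (indexCount j q) with hj | hj
      · rw [hj, mul_zero, Nat.le_zero]
        refine Nat.eq_zero_of_not_pos fun hz => ?_
        obtain ⟨c, hc, rfl⟩ := indexCount_pos.1 hz
        exact (hpos c hc).ne' hj
      · exact indexCount_le_of_conn hpq.right hconn h6 hi hj
    have h9 := (perm_of_trace_eq h1).length_eq
    have h10 := (perm_of_trace_eq h2).length_eq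
    have h11 := (perm_of_trace_eq h5).length_eq
    have h12 := (perm_of_trace_append_eq h6).length_eq
    have h13 : 0 < q.length := List.length_pos_of_mem ha
    simp only [List.length_append, invWord, List.length_reverse, List.length_map] at h9 h10 h11
    have h14 : b.length = 2 * m.length + q.length := by omega
    rw [h14, h10]
    nlinarith [Nat.zero_le (m.length * q.length), Nat.zero_le (m.length ^ 2)]

lemma trace_mul_letter_of_append {s q u : List (Fin k × Bool)} {b : Fin k × Bool}
    (h : trace F (s ++ q) = trace F u * letter F b) :
    ∃ v, trace F (s ++ q ++ q) = trace F v * letter F b := by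
  obtain ⟨v, t, hst, ht⟩ := exists_split_of_mul_letter h
  by_cases hq : ∀ c ∈ q, ¬ Dep F b.1 c.1
  · refine ⟨u ++ q, ?_⟩
    rw [trace_append, h, mul_assoc, (letter_commute_trace hq).eq, ← mul_assoc, ← trace_append]
  · have key : ∀ l, q = l ++ b :: t → ∃ v, trace F (s ++ q ++ q) = trace F v * letter F b := by
      intro l hl
      refine ⟨s ++ q ++ (l ++ t), ?_⟩
      rw [trace_append (s ++ q), trace_append (s ++ q) (l ++ t),
        mul_assoc, ← trace_split_right ht, ← hl]
    rcases List.append_eq_append_iff.1 hst with ⟨l, h1, h2⟩ | ⟨l, h1, h2⟩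
    · exact key l h2
    · rcases l with _ | ⟨d, l⟩
      · exact key [] (by simpa using h2.symm)
      · simp only [List.cons_append, List.cons.injEq] at h2
        exact absurd (fun c hc => ht c (by simp [h2.2, hc])) hq

end


/-- for connected `q` containing `α` and an `α`-peak `p ≤ pq`,
there are an `α`-peak `r` and `t ≥ 0` with `p = r·qᵗ` and `|r| ≤ 2|pqp⁻¹|²`. -/
theorem stmt18 {k : ℕ} (hk : 1 ≤ k) {F : Set (Sym2 (Fin k))}
    (α : Fin k × Bool) (q p : Grp k F)
    (hq : Conn q) (hα : Occurs α q)
    (hp : AlphaPeak α p) (hpq : le p (p * q)) :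
    ∃ (r : Grp k F) (t : ℕ), AlphaPeak α r ∧ p = r * q ^ t ∧
      len p = len r + t * len q ∧
      len r ≤ 2 * (len (p * q * p⁻¹)) ^ 2 := by
  obtain ⟨Q, hQ, rfl⟩ := exists_reduced q
  have hαQ := (occurs_iff hQ).1 hα
  have hQ0 : 0 < Q.length := List.length_pos_of_mem hαQ
  induction hn : len p using Nat.strong_induction_on generalizing p with
  | _ n ih =>
  subst hn
  obtain ⟨P, hP, rfl⟩ := exists_reduced p
  obtain ⟨A, hA, hAp⟩ := exists_reduced (wordProd k F P * wordProd k F Q * (wordProd k F P)⁻¹)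
  have hPQ : Reduced F (P ++ Q) := by
    refine reduced_of_length_le ?_
    rw [le, inv_mul_cancel_left, hP.len_eq, hQ.len_eq] at hpq
    rw [wordProd_append, hpq, List.length_append]
  have hmax : ∀ β u, trace F P = trace F u * letter F β → β = α := fun β u h =>
    hp.2 β ((maxSym_iff hP).2 ⟨u, h⟩)
  rcases length_le_or_exists hPQ hA (by rw [hAp]; simp) hq hαQ hmax with h | ⟨S, hS⟩
  · refine ⟨wordProd k F P, 0, hp, by simp, by simp, ?_⟩
    rwa [← hAp, hA.len_eq, hP.len_eq]
  · rw [← trace_append, ← trace_append] at hS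
    have hSQQ := hP.congr hS
    have hSQ := hSQQ.left
    have heq : wordProd k F P = wordProd k F (S ++ Q) * wordProd k F Q := by
      rw [wordProd_eq_of_trace_eq hS, wordProd_append (S ++ Q)]
    have hlen : len (wordProd k F P) = len (wordProd k F (S ++ Q)) + len (wordProd k F Q) := by
      rw [hP.len_eq, hSQ.len_eq, hQ.len_eq, (perm_of_trace_eq hS).length_eq, List.length_append]
    have hpeak : AlphaPeak α (wordProd k F (S ++ Q)) := by
      constructor
      · obtain ⟨Q', β, rfl⟩ := List.eq_nil_or_concat Q |>.resolve_left
          (by rintro rfl; simp at hQ0)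
        have hβ := hmax β (S ++ Q'.concat β ++ Q') (by rw [hS]; simp [mul_assoc])
        subst hβ
        exact (maxSym_iff hSQ).2 ⟨S ++ Q', by simp [mul_assoc]⟩
      · intro β hβ
        obtain ⟨u, hu⟩ := (maxSym_iff hSQ).1 hβ
        obtain ⟨v, hv⟩ := trace_mul_letter_of_append hu
        exact hmax β v (hS.trans hv)
    have hle : le (wordProd k F (S ++ Q)) (wordProd k F (S ++ Q) * wordProd k F Q) := by
      rw [le, inv_mul_cancel_left, ← heq, hlen]
    obtain ⟨r, t, hr, hrt, hl, hb⟩ := ih _ (by rw [hlen, hQ.len_eq]; omega) _ hpeak hle rfl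
    refine ⟨r, t + 1, hr, ?_, ?_, ?_⟩
    · rw [heq, hrt, pow_succ, mul_assoc]
    · rw [hlen, hl]
      ring
    · have : wordProd k F P * wordProd k F Q * (wordProd k F P)⁻¹ =
          wordProd k F (S ++ Q) * wordProd k F Q * (wordProd k F (S ++ Q))⁻¹ := by
        rw [heq]
        group
      rwa [this]

end GraphGroupPaper
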